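/- arXiv:1308.3268 — 2 statements merged into one kernel-verified Lean document; each statement's English description precedes it below -/
import Mathlib

section
/- Let G be a compact Hausdorff topological group and let ρ be a strongly continuous linear representation of G on a real Banach space X. If S ⊆ X is a closed G-invariant subspace which is complemented in X (i.e. there exists a closed subspace S' with X = S ⊕ S'), then S admits a G-invariant closed complement: there exists a closed subspace S'' ⊆ X with ρ(g)(S'') ⊆ S'' for all g ∈ G and X = S ⊕ S''. -/
/-- **Invariant complements for strongly continuous representations of compact groups.**
Let `G` be a compact Hausdorff topological group and `ρ` a strongly continuous linear
representation of `G` on a real Banach space `X`.  If `S ⊆ X` is a closed `G`-invariant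
subspace which is complemented (there is a closed subspace `S'` with `X = S ⊕ S'`), then
`S` admits a `G`-invariant closed complement `S''`. -/
theorem invariant_closed_complement_of_strongly_continuous_rep
    {G : Type*} [Group G] [TopologicalSpace G] [IsTopologicalGroup G]
    [CompactSpace G] [T2Space G]
    {X : Type*} [NormedAddCommGroup X] [NormedSpace ℝ X] [CompleteSpace X]
    (ρ : G →* (X ≃L[ℝ] X))
    (hρ : ∀ x : X, Continuous fun g : G => ρ g x)
    (S : Submodule ℝ X) (hSclosed : IsClosed (S : Set X))
    (hSinv : ∀ (g : G), ∀ x ∈ S, ρ g x ∈ S)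
    (hScompl : ∃ S' : Submodule ℝ X, IsClosed (S' : Set X) ∧ IsCompl S S') :
    ∃ S'' : Submodule ℝ X, IsClosed (S'' : Set X) ∧
      (∀ (g : G), ∀ x ∈ S'', ρ g x ∈ S'') ∧ IsCompl S S'' := by
  obtain ⟨S', hS'closed, hcompl⟩ := hScompl
  -- a continuous projection onto `S`
  obtain ⟨p, hp⟩ := Submodule.ClosedComplemented.of_isCompl_isClosed hcompl hSclosed hS'closed
  let P : X →L[ℝ] X := S.subtypeL.comp p
  have hPmem : ∀ x, P x ∈ S := fun x => (p x).2
  have hPid : ∀ x ∈ S, P x = x := fun x hx => congrArg Subtype.val (hp ⟨x, hx⟩)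
  -- uniform boundedness
  obtain ⟨C, hC⟩ : ∃ C, ∀ g, ‖((ρ g : X ≃L[ℝ] X) : X →L[ℝ] X)‖ ≤ C := by
    apply banach_steinhaus
    intro x
    obtain ⟨C, hC⟩ := (isCompact_range (hρ x)).isBounded.exists_norm_le
    exact ⟨C, fun g => hC _ ⟨g, rfl⟩⟩
  have hC' : ∀ g x, ‖ρ g x‖ ≤ C * ‖x‖ := fun g x =>
    ((ρ g : X ≃L[ℝ] X) : X →L[ℝ] X).le_of_opNorm_le (hC g) x
  have hC0 : 0 ≤ C := (norm_nonneg _).trans (hC 1)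
  have hmul : ∀ g h x, ρ (g * h) x = ρ g (ρ h x) := fun g h x => by
    rw [map_mul]; rfl
  have hone : ∀ x, ρ 1 x = x := fun x => by rw [map_one]; rfl
  have hjoint : ∀ y : G → X, Continuous y → Continuous fun g => ρ g (y g) := by
    intro y hy
    rw [continuous_iff_continuousAt]
    intro g₀
    have h1 : Filter.Tendsto (fun g => ρ g (y g - y g₀)) (nhds g₀) (nhds 0) := by
      apply squeeze_zero_norm (fun g => hC' g _)
      have : Continuous fun g => C * ‖y g - y g₀‖ := by fun_prop
      simpa using this.tendsto g₀
    have h2 := h1.add ((hρ (y g₀)).tendsto g₀)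
    simpa [ContinuousAt] using h2
  let f : X → G → X := fun x g => ρ g (P (ρ g⁻¹ x))
  have hf : ∀ x, Continuous (f x) := fun x =>
    hjoint _ (P.continuous.comp ((hρ x).comp continuous_inv))
  have hfmem : ∀ x g, f x g ∈ S := fun x g => hSinv g _ (hPmem _)
  have hfid : ∀ x ∈ S, ∀ g, f x g = x := fun x hx g => by
    change ρ g (P (ρ g⁻¹ x)) = x
    rw [hPid _ (hSinv _ _ hx), ← hmul, mul_inv_cancel, hone]
  have hfb : ∀ x g, ‖f x g‖ ≤ C * (‖P‖ * C) * ‖x‖ := fun x g => by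
    calc ‖f x g‖ ≤ C * ‖P (ρ g⁻¹ x)‖ := hC' _ _
      _ ≤ C * (‖P‖ * (C * ‖x‖)) := by
        gcongr
        exact (P.le_opNorm _).trans (by gcongr; exact hC' _ _)
      _ = _ := by ring
  -- Haar measure
  let _ : MeasurableSpace G := borel G
  have : BorelSpace G := ⟨rfl⟩
  let K : TopologicalSpace.PositiveCompacts G := ⊤
  let μ : MeasureTheory.Measure G := MeasureTheory.Measure.haarMeasure K
  have : MeasureTheory.IsProbabilityMeasure μ :=
    ⟨by simpa [K] using MeasureTheory.Measure.haarMeasure_self (K₀ := K)⟩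
  have hint : ∀ x, MeasureTheory.Integrable (f x) μ := fun x =>
    (hf x).integrable_of_hasCompactSupport (HasCompactSupport.of_compactSpace _)
  let Q₀ : X →ₗ[ℝ] X :=
    { toFun := fun x => ∫ g, f x g ∂μ
      map_add' := fun x y => by
        rw [← MeasureTheory.integral_add (hint x) (hint y)]
        simp [f]
      map_smul' := fun c x => by
        rw [RingHom.id_apply, ← MeasureTheory.integral_smul]
        simp [f] }
  let Q : X →L[ℝ] X := Q₀.mkContinuous (C * (‖P‖ * C)) fun x => by
    change ‖∫ g, f x g ∂μ‖ ≤ _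
    simpa using MeasureTheory.norm_integral_le_of_norm_le_const (μ := μ)
      (Filter.Eventually.of_forall (hfb x))
  have hQ : ∀ x, Q x = ∫ g, f x g ∂μ := fun x => rfl
  have hQmem : ∀ x, Q x ∈ S := fun x => by
    have : P (Q x) = Q x := by
      rw [hQ, ← P.integral_comp_comm (hint x)]
      exact MeasureTheory.integral_congr_ae
        (Filter.Eventually.of_forall fun g => hPid _ (hfmem x g))
    rw [← this]
    exact hPmem _
  have hQid : ∀ x ∈ S, Q x = x := fun x hx => by
    rw [hQ]
    simp [hfid x hx]
  have hQeq : ∀ h x, Q (ρ h x) = ρ h (Q x) := fun h x => by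
    have h1 : ρ h (Q x) = ∫ g, ρ h (f x g) ∂μ :=
      (((ρ h : X ≃L[ℝ] X) : X →L[ℝ] X).integral_comp_comm (hint x)).symm
    rw [h1, hQ, ← MeasureTheory.integral_mul_left_eq_self (f (ρ h x)) h]
    congr 1
    funext g
    change ρ (h * g) (P (ρ (h * g)⁻¹ (ρ h x))) = ρ h (ρ g (P (ρ g⁻¹ x)))
    rw [hmul, ← hmul (h * g)⁻¹ h x]
    simp
  refine ⟨LinearMap.ker (Q : X →ₗ[ℝ] X), Q.isClosed_ker, ?_, ?_⟩
  · intro g x hx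
    have hx' : Q x = 0 := hx
    change Q (ρ g x) = 0
    rw [hQeq, hx', map_zero]
  · constructor
    · rw [Submodule.disjoint_def]
      intro x hx hk
      rw [← hQid x hx]
      exact hk
    · rw [codisjoint_iff, Submodule.eq_top_iff']
      intro x
      rw [Submodule.mem_sup]
      refine ⟨Q x, hQmem x, x - Q x, ?_, by abel⟩
      change Q (x - Q x) = 0
      rw [map_sub, hQid _ (hQmem x), sub_self]
end

section
/- Let N be a real Banach space, Q ⊆ N a closed subspace, and F ⊆ N a finite-dimensional subspace such that N = Q ⊕ F (internal direct sum, so the projection π : N → F along Q is continuous). Let A be a topological space, s ≥ dim F an integer, and χ : A × ℝ^s → N a continuous map. Assume there exist a₀ ∈ A and m₀ ∈ ℝ^s such that: (a) χ(a₀, m₀) ∈ Q; (b) χ(a₀, ·) : ℝ^s → N is of class C¹; (c) the range of the derivative of χ(a₀, ·) at m₀ together with Q spans N, i.e. Dχ(a₀, ·)(m₀)(ℝ^s) + Q = N. Then there exists a neighborhood W of a₀ in A such that for every a ∈ W there exists m ∈ ℝ^s with χ(a, m) ∈ Q. -/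
open Set Metric MeasureTheory in
/-- `det (1 + t A)` is a polynomial in `t` of degree at most the dimension. -/
lemma det_one_add_smul_poly {n : ℕ} (A : EuclideanSpace ℝ (Fin n) →L[ℝ] EuclideanSpace ℝ (Fin n)) :
    ∃ p : Polynomial ℝ, p.natDegree ≤ n ∧
      ∀ t : ℝ, (ContinuousLinearMap.id ℝ _ + t • A).det = p.eval t := by
  let b := (EuclideanSpace.basisFun (Fin n) ℝ).toBasis
  let M := LinearMap.toMatrix b b A.toLinearMap
  refine ⟨((Polynomial.X : Polynomial ℝ) • M.map Polynomial.C
    + (1 : Matrix (Fin n) (Fin n) ℝ).map Polynomial.C).det, ?_, fun t => ?_⟩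
  · simpa using Polynomial.natDegree_det_X_add_C_le M 1
  · have h1 : (ContinuousLinearMap.id ℝ _ + t • A).det = (1 + t • M).det := by
      rw [ContinuousLinearMap.det, ← LinearMap.det_toMatrix b]
      congr 1
      simp [M]
    rw [h1, ← Polynomial.coe_evalRingHom, RingHom.map_det]
    congr 1
    ext i j
    by_cases hij : i = j <;> simp [hij] <;> ring

open Set Metric MeasureTheory in
/-- If `∫ det (1 + t A)` is constant for small `t > 0` then it has the same value at `t = 1`. -/
lemma integral_det_extend {n : ℕ}
    (A : EuclideanSpace ℝ (Fin n) → EuclideanSpace ℝ (Fin n) →L[ℝ] EuclideanSpace ℝ (Fin n))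
    (s : Set (EuclideanSpace ℝ (Fin n)))
    (hInteg : ∀ t : ℝ, IntegrableOn (fun x => (ContinuousLinearMap.id ℝ _ + t • A x).det) s)
    (ε c : ℝ) (hε : 0 < ε)
    (hc : ∀ t : ℝ, 0 < t → t < ε →
      ∫ x in s, (ContinuousLinearMap.id ℝ _ + t • A x).det = c) :
    ∫ x in s, (ContinuousLinearMap.id ℝ _ + (1 : ℝ) • A x).det = c := by
  let S := Finset.range (n + 1)
  let τ : ℕ → ℝ := fun i => ε / (i + 2)
  have hτ0 : ∀ i, 0 < τ i := fun i => by positivity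
  have hτ1 : ∀ i, τ i < ε := fun i => by
    have : (0 : ℝ) ≤ i := Nat.cast_nonneg i
    simp only [τ]
    rw [div_lt_iff₀ (by positivity)]
    nlinarith
  have hinj : Set.InjOn τ S := by
    intro i _ j _ hij
    simp only [τ] at hij
    have hi : (0 : ℝ) < i + 2 := by positivity
    have hj : (0 : ℝ) < j + 2 := by positivity
    field_simp at hij
    have : (i : ℝ) = j := by linarith
    exact_mod_cast this
  have key : ∀ x, (ContinuousLinearMap.id ℝ _ + (1 : ℝ) • A x).det =
      ∑ i ∈ S, (Lagrange.basis S τ i).eval 1 *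
        (ContinuousLinearMap.id ℝ _ + τ i • A x).det := by
    intro x
    obtain ⟨p, hp, hpe⟩ := det_one_add_smul_poly (A x)
    have hd : p.degree < S.card := by
      refine lt_of_le_of_lt Polynomial.degree_le_natDegree ?_
      simp only [S, Finset.card_range]
      exact_mod_cast Nat.lt_succ_of_le hp
    rw [hpe]
    conv_lhs => rw [Lagrange.eq_interpolate hinj hd]
    rw [Lagrange.interpolate_apply, Polynomial.eval_finsetSum]
    refine Finset.sum_congr rfl fun i _ => ?_
    rw [hpe, Polynomial.eval_mul, Polynomial.eval_C, mul_comm]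
  simp_rw [key]
  rw [integral_finsetSum _ fun i _ => (hInteg (τ i)).const_mul _]
  simp_rw [integral_const_mul, hc _ (hτ0 _) (hτ1 _)]
  rw [← Finset.sum_mul, ← Polynomial.eval_finsetSum, Lagrange.sum_basis hinj ⟨0, by simp [S]⟩]
  simp

open Set Metric MeasureTheory in
/-- No `C¹` retraction of the ball onto the sphere. -/
lemma no_c1_retraction {n : ℕ} (v : EuclideanSpace ℝ (Fin n) → EuclideanSpace ℝ (Fin n))
    (hv : ContDiff ℝ 1 v) (hv1 : ∀ x, ‖x‖ = 1 → v x = x) (hv2 : ∀ x, ‖x‖ ≤ 1 → ‖v x‖ = 1) :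
    False := by
  classical
  let E := EuclideanSpace ℝ (Fin n)
  let A : E → E →L[ℝ] E := fun x => fderiv ℝ v x - ContinuousLinearMap.id ℝ E
  have hdv : Continuous (fderiv ℝ v) := hv.continuous_fderiv (by norm_num)
  have hA : Continuous A := hdv.sub continuous_const
  have hdiff : ∀ x, HasFDerivAt v (fderiv ℝ v x) x := fun x =>
    (hv.differentiable (by norm_num) x).hasFDerivAt
  have hcont : ∀ t : ℝ, Continuous fun x => (ContinuousLinearMap.id ℝ E + t • A x).det := fun t =>
    ContinuousLinearMap.continuous_det.comp (continuous_const.add (hA.const_smul t))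
  have hInteg : ∀ t : ℝ, IntegrableOn (fun x => (ContinuousLinearMap.id ℝ E + t • A x).det)
      (ball (0 : E) 1) := fun t =>
    ((hcont t).continuousOn.integrableOn_compact (isCompact_closedBall (0 : E) 1)).mono_set
      ball_subset_closedBall
  -- the displacement, extended by zero
  let h : E → E := fun x => if ‖x‖ ≤ 1 then v x - x else 0
  have hin : ∀ x, ‖x‖ ≤ 1 → h x = v x - x := fun x hx => if_pos hx
  have hout : ∀ x, 1 ≤ ‖x‖ → h x = 0 := by
    intro x hx
    rcases hx.eq_or_lt with hx | hx
    · rw [hin x hx.symm.le, hv1 x hx.symm, sub_self]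
    · exact if_neg (not_le.mpr hx)
  obtain ⟨K, hK⟩ : ∃ K, LipschitzOnWith K (fun x => v x - x) (closedBall (0 : E) 1) :=
    (hv.sub contDiff_id).contDiffOn.exists_lipschitzOnWith (by norm_num)
      (convex_closedBall _ _) (isCompact_closedBall _ _)
  have hKin : ∀ x y, ‖x‖ ≤ 1 → ‖y‖ ≤ 1 → dist (h x) (h y) ≤ K * dist x y := by
    intro x y hx hy
    rw [hin x hx, hin y hy]
    exact hK.dist_le_mul x (by simpa using hx) y (by simpa using hy)
  have hKmix : ∀ x y, ‖x‖ ≤ 1 → 1 ≤ ‖y‖ → dist (h x) (h y) ≤ K * dist x y := by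
    intro x y hx hy
    obtain ⟨z, hz, hz1⟩ := (convex_segment x y).isPreconnected.intermediate_value
      (left_mem_segment ℝ x y) (right_mem_segment ℝ x y) continuous_norm.continuousOn ⟨hx, hy⟩
    have h1 : h y = h z := by rw [hout y hy, hout z hz1.ge]
    rw [h1]
    refine (hKin x z hx hz1.le).trans ?_
    gcongr
    have := dist_add_dist_of_mem_segment hz
    have := dist_nonneg (x := z) (y := y)
    linarith
  have hKall : ∀ x y, dist (h x) (h y) ≤ K * dist x y := by
    intro x y
    rcases le_total ‖x‖ 1 with hx | hx <;> rcases le_total ‖y‖ 1 with hy | hy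
    · exact hKin x y hx hy
    · exact hKmix x y hx hy
    · rw [dist_comm, dist_comm x]; exact hKmix y x hy hx
    · rw [hout x hx, hout y hy, dist_self]; positivity
  -- positivity of the determinant near the identity
  obtain ⟨η, hη, hdet⟩ : ∃ η > 0, ∀ B : E →L[ℝ] E, dist B (ContinuousLinearMap.id ℝ E) < η →
      0 < B.det := by
    have h1 : ∀ᶠ B in nhds (ContinuousLinearMap.id ℝ E), 0 < B.det := by
      refine (ContinuousLinearMap.continuous_det (𝕜 := ℝ) (E := E)).continuousAt.eventually
        (lt_mem_nhds ?_)
      simp [ContinuousLinearMap.det]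
    exact Metric.eventually_nhds_iff.mp h1
  obtain ⟨C, hC⟩ := (isCompact_closedBall (0 : E) 1).exists_bound_of_continuousOn hA.continuousOn
  have hC0 : 0 ≤ C := (norm_nonneg _).trans (hC 0 (by simp))
  let ε : ℝ := min (1 / (K + 1)) (η / (C + 1))
  have hε : 0 < ε := lt_min (by positivity) (by positivity)
  have hconst : ∀ t : ℝ, 0 < t → t < ε →
      ∫ x in ball (0 : E) 1, (ContinuousLinearMap.id ℝ E + t • A x).det
        = volume.real (ball (0 : E) 1) := by
    intro t ht0 ht
    have htK : t * K < 1 := by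
      have h1 := ht.trans_le (min_le_left _ _)
      rw [lt_div_iff₀ (by positivity)] at h1
      nlinarith
    have htC : t * C < η := by
      have h1 := ht.trans_le (min_le_right _ _)
      rw [lt_div_iff₀ (by positivity)] at h1
      nlinarith
    let φ : E → E := fun x => x + t • h x
    have hφout : ∀ x, 1 ≤ ‖x‖ → φ x = x := fun x hx => by simp [φ, hout x hx]
    have hφinj : Function.Injective φ := by
      intro x y hxy
      have h1 : x - y = t • (h y - h x) := by
        simp only [φ] at hxy
        rw [smul_sub, sub_eq_sub_iff_add_eq_add, hxy, add_comm]
      have h2 : dist x y ≤ t * (K * dist x y) := by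
        calc dist x y = t * dist (h x) (h y) := by
              rw [dist_eq_norm, h1, norm_smul, Real.norm_of_nonneg ht0.le, dist_comm, dist_eq_norm]
          _ ≤ _ := by gcongr; exact hKall x y
      have h3 := dist_nonneg (x := x) (y := y)
      exact dist_le_zero.mp (by nlinarith)
    have hφsurj : Function.Surjective φ := by
      intro y
      have hcw : ContractingWith (Real.toNNReal (t * K)) (fun x => y - t • h x) := by
        refine ⟨by simpa using htK, LipschitzWith.of_dist_le_mul fun a b => ?_⟩
        rw [Real.coe_toNNReal _ (by positivity), dist_sub_left, dist_smul₀,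
          Real.norm_of_nonneg ht0.le, mul_assoc]
        gcongr
        exact hKall a b
      have h1 := hcw.fixedPoint_isFixedPt
      refine ⟨hcw.fixedPoint, ?_⟩
      have h2 : y - t • h hcw.fixedPoint = hcw.fixedPoint := h1
      simp only [φ]
      nth_rewrite 1 [← h2]
      abel
    have himg : φ '' ball (0 : E) 1 = ball (0 : E) 1 := by
      ext y
      constructor
      · rintro ⟨x, hx, rfl⟩
        by_contra hy
        rw [mem_ball_zero_iff, not_lt] at hy
        have h1 := hφinj (hφout _ hy)
        rw [h1] at hy
        rw [mem_ball_zero_iff] at hx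
        linarith
      · intro hy
        obtain ⟨x, rfl⟩ := hφsurj y
        refine ⟨x, ?_, rfl⟩
        by_contra hx
        rw [mem_ball_zero_iff, not_lt] at hx
        rw [hφout x hx, mem_ball_zero_iff] at hy
        linarith
    have hφd : ∀ x ∈ ball (0 : E) 1,
        HasFDerivWithinAt φ (ContinuousLinearMap.id ℝ E + t • A x) (ball (0 : E) 1) x := by
      intro x hx
      have h1 : HasFDerivAt (fun x => x + t • (v x - x))
          (ContinuousLinearMap.id ℝ E + t • A x) x :=
        (hasFDerivAt_id x).add (((hdiff x).sub (hasFDerivAt_id x)).const_smul t)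
      refine h1.hasFDerivWithinAt.congr (fun y hy => ?_) ?_
      · simp only [φ]; rw [hin y (mem_ball_zero_iff.mp hy).le]
      · simp only [φ]; rw [hin x (mem_ball_zero_iff.mp hx).le]
    have h1 := integral_image_eq_integral_abs_det_fderiv_smul volume measurableSet_ball hφd
      hφinj.injOn (fun _ => (1 : ℝ))
    rw [himg] at h1
    simp only [smul_eq_mul, mul_one] at h1
    rw [setIntegral_const, smul_eq_mul, mul_one] at h1
    rw [h1]
    refine setIntegral_congr_fun measurableSet_ball fun x hx => ?_
    refine (abs_of_pos (hdet _ ?_)).symm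
    rw [dist_eq_norm, add_sub_cancel_left, norm_smul, Real.norm_of_nonneg ht0.le]
    refine lt_of_le_of_lt ?_ htC
    gcongr
    exact hC x (ball_subset_closedBall hx)
  have hfin := integral_det_extend A _ hInteg ε _ hε hconst
  have hzero : ∀ x ∈ ball (0 : E) 1, (ContinuousLinearMap.id ℝ E + (1 : ℝ) • A x).det = 0 := by
    intro x hx
    have h0 : ContinuousLinearMap.id ℝ E + (1 : ℝ) • A x = fderiv ℝ v x := by simp [A]
    rw [h0]
    by_contra hne
    have hsurj : Function.Surjective (fderiv ℝ v x) := by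
      exact (LinearMap.equivOfDetNeZero (fderiv ℝ v x).toLinearMap hne).surjective
    obtain ⟨w, hw⟩ := hsurj (v x)
    have h2 : HasFDerivAt (fun y => ‖v y‖ ^ 2) _ x := (hdiff x).norm_sq
    have h3 : HasFDerivAt (fun y => ‖v y‖ ^ 2) (0 : E →L[ℝ] ℝ) x := by
      refine (hasFDerivAt_const (1 : ℝ) x).congr_of_eventuallyEq ?_
      filter_upwards [isOpen_ball.mem_nhds hx] with y hy
      rw [hv2 y (mem_ball_zero_iff.mp hy).le]; norm_num
    have h4 := congrArg (fun L : E →L[ℝ] ℝ => L w) (h2.unique h3)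
    have h5 := hv2 x (mem_ball_zero_iff.mp hx).le
    simp [hw, h5] at h4
  rw [setIntegral_congr_fun measurableSet_ball hzero] at hfin
  have hpos : 0 < volume.real (ball (0 : E) 1) :=
    ENNReal.toReal_pos (measure_ball_pos volume _ one_pos).ne' measure_ball_lt_top.ne
  rw [← hfin, integral_zero] at hpos
  exact lt_irrefl _ hpos

open Set Metric in
/-- A continuous map close to the identity on the unit ball has a zero there. -/
lemma exists_zero_of_near_id {n : ℕ} (g : EuclideanSpace ℝ (Fin n) → EuclideanSpace ℝ (Fin n))
    (hg : Continuous g) (hgx : ∀ x, ‖x‖ ≤ 1 → ‖g x - x‖ ≤ 1 / 4) : ∃ x, g x = 0 := by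
  by_contra! hne
  let E := EuclideanSpace ℝ (Fin n)
  obtain ⟨δ, hδ, hgδ⟩ : ∃ δ > 0, ∀ x : E, ‖x‖ ≤ 1 → δ ≤ ‖g x‖ := by
    obtain ⟨z, -, hz⟩ := (isCompact_closedBall (0 : E) 1).exists_isMinOn ⟨0, by simp⟩
      hg.norm.continuousOn
    exact ⟨‖g z‖, norm_pos_iff.mpr (hne z), fun x hx => hz (by simpa using hx)⟩
  obtain ⟨p, hp, hpg, -⟩ := hg.exists_contDiff_approx 1 (ε := fun _ => min δ (1 / 4))
    continuous_const (fun _ => by positivity)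
  let c : ContDiffBump (0 : E) := ⟨3 / 4, 1, by norm_num, by norm_num⟩
  let u : E → E := fun x => x + c x • (p x - x)
  have hu : ContDiff ℝ 1 u :=
    contDiff_id.add (c.contDiff.smul ((by exact_mod_cast hp : ContDiff ℝ 1 p).sub contDiff_id))
  have huout : ∀ x, 1 ≤ ‖x‖ → u x = x := by
    intro x hx
    have : c x = 0 := c.zero_of_le_dist (by simpa using hx)
    simp [u, this]
  have hune : ∀ x, u x ≠ 0 := by
    intro x hx0
    rcases le_or_gt 1 ‖x‖ with hx | hx
    · rw [huout x hx] at hx0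
      rw [hx0, norm_zero] at hx
      linarith
    have h1 := hpg x
    rw [dist_eq_norm] at h1
    rcases le_or_gt ‖x‖ (3 / 4) with hx' | hx'
    · have : c x = 1 := c.one_of_mem_closedBall (by simpa using hx')
      simp only [u, this, one_smul, add_sub_cancel] at hx0
      rw [hx0, zero_sub, norm_neg] at h1
      have := hgδ x hx.le
      have := min_le_left δ (1 / 4)
      linarith
    · have h2 : ‖p x - x‖ ≤ 1 / 2 := by
        have := norm_sub_le_norm_sub_add_norm_sub (p x) (g x) x
        have := hgx x hx.le
        have := min_le_right δ (1 / 4)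
        linarith
      have h3 : ‖c x • (p x - x)‖ ≤ 1 / 2 := by
        rw [norm_smul, Real.norm_of_nonneg c.nonneg]
        nlinarith [c.le_one (x := x), c.nonneg (x := x), norm_nonneg (p x - x)]
      have h4 : x = -(c x • (p x - x)) := eq_neg_of_add_eq_zero_left hx0
      have h5 : ‖x‖ ≤ 1 / 2 := by rw [h4, norm_neg]; exact h3
      linarith
  refine no_c1_retraction (fun x => ‖u x‖⁻¹ • u x) ?_ ?_ ?_
  · exact ((hu.norm ℝ hune).inv fun x => norm_ne_zero_iff.mpr (hune x)).smul hu
  · intro x hx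
    simp [huout x hx.ge, hx]
  · intro x _
    rw [norm_smul, norm_inv, norm_norm, inv_mul_cancel₀ (norm_ne_zero_iff.mpr (hune x))]


/-- **Nonempty intersection with a finite-codimension subspace (Proposition on slices).**
Let `N` be a real Banach space, `Q ⊆ N` a closed subspace and `F ⊆ N` a finite-dimensional
subspace with `N = Q ⊕ F`.  Let `A` be a topological space, `s ≥ dim F`, and
`χ : A × ℝ^s → N` continuous.  If `χ(a₀, m₀) ∈ Q`, `χ(a₀, ·)` is `C¹`, and the range of
the derivative of `χ(a₀, ·)` at `m₀` together with `Q` spans `N`, then for all `a` in a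
neighborhood of `a₀` there exists `m` with `χ(a, m) ∈ Q`. -/
theorem nonempty_intersection_near
    {N : Type*} [NormedAddCommGroup N] [NormedSpace ℝ N] [CompleteSpace N]
    (Q F : Submodule ℝ N) (hQ : IsClosed (Q : Set N)) [FiniteDimensional ℝ F]
    (hcompl : IsCompl Q F)
    {A : Type*} [TopologicalSpace A] {s : ℕ} (hs : Module.finrank ℝ F ≤ s)
    (χ : A → EuclideanSpace ℝ (Fin s) → N)
    (hχ : Continuous fun p : A × EuclideanSpace ℝ (Fin s) => χ p.1 p.2)
    (a₀ : A) (m₀ : EuclideanSpace ℝ (Fin s))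
    (ha : χ a₀ m₀ ∈ Q)
    (hb : ContDiff ℝ 1 (χ a₀))
    (hc : LinearMap.range (fderiv ℝ (χ a₀) m₀).toLinearMap ⊔ Q = ⊤) :
    ∃ W ∈ nhds a₀, ∀ a ∈ W, ∃ m : EuclideanSpace ℝ (Fin s), χ a m ∈ Q := by
  classical
  have hF : IsClosed (F : Set N) := F.closed_of_finiteDimensional
  have htc : Submodule.IsTopCompl F Q := Submodule.IsCompl.isTopCompl_of_isClosed hcompl.symm hF hQ
  let E := EuclideanSpace ℝ (Fin (Module.finrank ℝ F))
  let e : F ≃L[ℝ] E := ContinuousLinearEquiv.ofFinrankEq (by simp [E])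
  let P : N →L[ℝ] E := e.toContinuousLinearMap.comp (F.projectionOntoL Q htc)
  have hP0 : ∀ x, P x = 0 ↔ x ∈ Q := fun x => by
    simp [P, -Submodule.coe_projectionOntoL, Submodule.projectionOntoL_apply_eq_zero_iff]
  have hPs : Function.Surjective P :=
    e.surjective.comp (Submodule.projectionOntoL_surjective htc)
  let D := fderiv ℝ (χ a₀) m₀
  have hD : HasFDerivAt (χ a₀) D m₀ := (hb.differentiable (by norm_num) m₀).hasFDerivAt
  have hsurj : Function.Surjective (P.comp D) := by
    intro y
    obtain ⟨x, rfl⟩ := hPs y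
    have hx : x ∈ LinearMap.range D.toLinearMap ⊔ Q := by rw [hc]; trivial
    obtain ⟨_, ⟨w, rfl⟩, q, hq, rfl⟩ := Submodule.mem_sup.mp hx
    exact ⟨w, by simp [(hP0 q).mpr hq]⟩
  obtain ⟨T, hT⟩ := (P.comp D).exists_rightInverse_of_surjective
    (LinearMap.range_eq_top.mpr hsurj)
  let G : A → E → E := fun a y => P (χ a (m₀ + T y))
  have hG : Continuous fun q : A × E => G q.1 q.2 :=
    P.continuous.comp (hχ.comp (continuous_fst.prodMk
      (continuous_const.add (T.continuous.comp continuous_snd))))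
  have hG0 : G a₀ 0 = 0 := by simp [G, (hP0 _).mpr ha]
  have hGd : HasFDerivAt (G a₀) (ContinuousLinearMap.id ℝ E) 0 := by
    have h1 : HasFDerivAt (fun y : E => m₀ + T y) T 0 := T.hasFDerivAt.const_add m₀
    have h2 : HasFDerivAt (χ a₀) D (m₀ + T 0) := by simpa using hD
    have h3 := P.hasFDerivAt.comp (0 : E) (h2.comp (0 : E) h1)
    rw [← ContinuousLinearMap.comp_assoc, hT] at h3
    exact h3
  obtain ⟨r, hr, hGr⟩ : ∃ r > 0, ∀ y : E, ‖y‖ ≤ r → ‖G a₀ y - y‖ ≤ 1 / 8 * ‖y‖ := by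
    have h1 := hGd.isLittleO.def (show (0 : ℝ) < 1 / 8 by norm_num)
    obtain ⟨r, hr, h2⟩ := Metric.eventually_nhds_iff.mp h1
    refine ⟨r / 2, by positivity, fun y hy => ?_⟩
    have h3 := h2 (y := y) (by rw [dist_zero_right]; linarith)
    simpa [hG0] using h3
  have hW : ∀ᶠ a in nhds a₀, ∀ y ∈ Metric.closedBall (0 : E) r, dist (G a y) (G a₀ y) < r / 8 := by
    refine (isCompact_closedBall (0 : E) r).eventually_forall_of_forall_eventually fun y _ => ?_
    have h1 : Continuous fun q : A × E => dist (G q.1 q.2) (G a₀ q.2) :=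
      hG.dist (hG.comp (continuous_const.prodMk continuous_snd))
    refine h1.continuousAt.eventually (gt_mem_nhds ?_)
    simp; positivity
  refine ⟨_, hW, fun a haW => ?_⟩
  obtain ⟨x, hx⟩ := exists_zero_of_near_id (fun x : E => r⁻¹ • G a (r • x))
    ((hG.comp (continuous_const.prodMk (continuous_const_smul r))).const_smul r⁻¹) (by
      intro x hx
      have h0 : ‖r • x‖ ≤ r := by
        rw [norm_smul, Real.norm_of_nonneg hr.le]; nlinarith
      have h1 := haW (r • x) (by simpa using h0)
      have h2 := hGr (r • x) h0
      rw [dist_eq_norm] at h1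
      have h3 := norm_sub_le_norm_sub_add_norm_sub (G a (r • x)) (G a₀ (r • x)) (r • x)
      have h4 : r⁻¹ • G a (r • x) - x = r⁻¹ • (G a (r • x) - r • x) := by
        rw [smul_sub, inv_smul_smul₀ hr.ne']
      rw [h4, norm_smul, norm_inv, Real.norm_of_nonneg hr.le, inv_mul_le_iff₀ hr]
      linarith)
  refine ⟨m₀ + T (r • x), (hP0 _).mp ?_⟩
  exact (smul_eq_zero_iff_right (inv_ne_zero hr.ne')).mp hx
end
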